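/- Let p be a prime, let α₁,...,α_N be a finite sequence in ℤ_p, and define f : ℤ_p × ℤ_p → ℝ by f(x,y) = #{n ≤ N : α_n ∈ D(x,|y|_p)}/N − |y|_p. Suppose (x₀,y₀) ∈ ℤ_p × ℤ_p satisfies f(x₀,y₀) < 0, and set Δ = −f(x₀,y₀). Then ∬_{ℤ_p×ℤ_p} |f(x,y)|² dμ(x) dμ(y) ≥ (1 − 1/p)·Δ⁴. -/

import Mathlib

open MeasureTheory Filter Finset
open scoped Classical

noncomputable section

/-- The Prüfer `p`-group `ℤ(p^∞)`: the set of all `p`-power roots of unity in `ℂ`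
(a multiplicative group). -/
def prufer (p : ℕ) : Set ℂ := {z : ℂ | ∃ n : ℕ, z ^ p ^ n = 1}

/-- For a `p`-power root of unity `ζ` of order `p^j` and `x ∈ ℤ_p` with canonical expansion
`x = a₀ + a₁ p + a₂ p² + ...`, this is `ζ^x := ζ^(a₀ + a₁ p + ... + a_{j-1} p^{j-1})`.
(Here `x.appr n = a₀ + a₁ p + ... + a_{n-1} p^{n-1}`; since `orderOf ζ = p^j ≥ j`, the
exponent `x.appr (orderOf ζ)` is congruent to the truncation `a₀ + ... + a_{j-1} p^{j-1}`
modulo `p^j = orderOf ζ`, so this agrees with the paper's definition.) -/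
def pruferChar (p : ℕ) [Fact p.Prime] (ζ : ℂ) (x : ℤ_[p]) : ℂ :=
  ζ ^ (x.appr (orderOf ζ))

/-- The discrepancy `D_N` of the finite sequence `α 1, ..., α N` in `ℤ_p`:
`D_N = sup_{a ∈ ℤ_p, k ∈ ℕ} | #{1 ≤ n ≤ N : αₙ ∈ D(a, 1/p^k)} / N - 1/p^k |`,
where `D(a, 1/p^k) = {z : |z - a|_p ≤ p^{-k}}`. -/
def disc (p : ℕ) [Fact p.Prime] (N : ℕ) (α : ℕ → ℤ_[p]) : ℝ :=
  ⨆ (a : ℤ_[p]) (k : ℕ),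
    |(((Finset.Icc 1 N).filter fun n => ‖α n - a‖ ≤ (p : ℝ) ^ (-(k : ℤ))).card : ℝ) / N
      - (p : ℝ) ^ (-(k : ℤ))|

/-- The local discrepancy function `f(x, y) = #{1 ≤ n ≤ N : αₙ ∈ D(x, |y|_p)} / N - |y|_p`. -/
def discFun (p : ℕ) [Fact p.Prime] (N : ℕ) (α : ℕ → ℤ_[p]) (x y : ℤ_[p]) : ℝ :=
  (((Finset.Icc 1 N).filter fun n => ‖α n - x‖ ≤ ‖y‖).card : ℝ) / N - ‖y‖

/-- A sequence `α` is equidistributed in `ℤ_p` if for every disc `D(a, 1/p^k)` the proportion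
of the first `N` terms lying in the disc tends to `1/p^k`. -/
def Equidistributed (p : ℕ) [Fact p.Prime] (α : ℕ → ℤ_[p]) : Prop :=
  ∀ (a : ℤ_[p]) (k : ℕ),
    Tendsto (fun N : ℕ =>
        |(((Finset.Icc 1 N).filter fun n => ‖α n - a‖ ≤ (p : ℝ) ^ (-(k : ℤ))).card : ℝ) / N
          - (p : ℝ) ^ (-(k : ℤ))|)
      atTop (nhds 0)

instance (p : ℕ) [Fact p.Prime] : MeasurableSpace ℤ_[p] := borel _
instance (p : ℕ) [Fact p.Prime] : BorelSpace ℤ_[p] := ⟨rfl⟩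

/-- A closed disc of radius `p ^ (-n)` in `ℤ_[p]` has Haar measure `p ^ (-n)`. -/
lemma measureReal_closedBall_zpow (p : ℕ) [Fact p.Prime] (μ : Measure ℤ_[p])
    [μ.IsAddHaarMeasure] [IsProbabilityMeasure μ] (a : ℤ_[p]) (n : ℕ) :
    μ.real (Metric.closedBall a ((p : ℝ) ^ (-(n : ℤ)))) = (p : ℝ) ^ (-(n : ℤ)) := by
  have hp : (p : ℝ) ≠ 0 := mod_cast (Fact.out : p.Prime).ne_zero
  let φ : ℤ_[p] →+ ZMod (p ^ n) := (PadicInt.toZModPow n : ℤ_[p] →+* ZMod (p ^ n)).toAddMonoidHom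
  have hker : (φ.ker : Set ℤ_[p]) = Metric.closedBall 0 ((p : ℝ) ^ (-(n : ℤ))) := by
    ext x
    rw [mem_closedBall_zero_iff, PadicInt.norm_le_pow_iff_mem_span_pow,
      ← PadicInt.ker_toZModPow]
    rfl
  have hindex : φ.ker.index = p ^ n := by
    have hsurj : Function.Surjective φ := ZMod.ringHom_surjective (PadicInt.toZModPow n)
    rw [AddSubgroup.index_ker, AddMonoidHom.range_eq_top.mpr hsurj]
    simp
  have : φ.ker.FiniteIndex := ⟨by rw [hindex]; exact mod_cast pow_ne_zero n (mod_cast hp)⟩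
  have hmul := φ.ker.index_mul_measure (hker ▸ measurableSet_closedBall) μ
  rw [hindex, hker, measure_univ] at hmul
  have hreal := congrArg ENNReal.toReal hmul
  simp only [ENNReal.toReal_mul, Nat.cast_pow, ENNReal.toReal_pow, ENNReal.toReal_natCast,
    ENNReal.toReal_one] at hreal
  rw [Measure.real, Measure.addHaar_closedBall_center, zpow_neg, zpow_natCast]
  rw [zpow_neg, zpow_natCast] at hreal
  exact eq_inv_of_mul_eq_one_right hreal

/-- The sphere of elements of norm `p ^ (-n)` in `ℤ_[p]` has Haar measure `(1 - 1/p) p ^ (-n)`. -/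
lemma measureReal_norm_eq_zpow (p : ℕ) [Fact p.Prime] (μ : Measure ℤ_[p])
    [μ.IsAddHaarMeasure] [IsProbabilityMeasure μ] (n : ℕ) :
    μ.real {y : ℤ_[p] | ‖y‖ = (p : ℝ) ^ (-(n : ℤ))}
      = (1 - 1 / (p : ℝ)) * (p : ℝ) ^ (-(n : ℤ)) := by
  have hp : (1 : ℝ) < p := mod_cast (Fact.out : p.Prime).one_lt
  have hset : {y : ℤ_[p] | ‖y‖ = (p : ℝ) ^ (-(n : ℤ))}
      = Metric.closedBall 0 ((p : ℝ) ^ (-(n : ℤ)))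
        \ Metric.closedBall 0 ((p : ℝ) ^ (-((n + 1 : ℕ) : ℤ))) := by
    ext y
    have hlt : ‖y‖ < (p : ℝ) ^ (-(n : ℤ)) ↔ ‖y‖ ≤ (p : ℝ) ^ (-((n + 1 : ℕ) : ℤ)) := by
      rw [PadicInt.norm_le_pow_iff_norm_lt_pow_add_one]
      norm_num
    simp only [Set.mem_ofPred_eq, Set.mem_sdiff, mem_closedBall_zero_iff, ← hlt, not_lt]
    exact le_antisymm_iff
  have hsub : Metric.closedBall (0 : ℤ_[p]) ((p : ℝ) ^ (-((n + 1 : ℕ) : ℤ)))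
      ⊆ Metric.closedBall 0 ((p : ℝ) ^ (-(n : ℤ))) :=
    Metric.closedBall_subset_closedBall (zpow_le_zpow_right₀ hp.le (by push_cast; omega))
  rw [hset, measureReal_sdiff hsub measurableSet_closedBall, measureReal_closedBall_zpow,
    measureReal_closedBall_zpow]
  have hstep : (p : ℝ) ^ (-((n + 1 : ℕ) : ℤ)) = (p : ℝ) ^ (-(n : ℤ)) * (1 / p) := by
    rw [Nat.cast_add, Nat.cast_one, neg_add, zpow_add₀ (by positivity), zpow_neg_one, one_div]
  rw [hstep]
  ring

lemma measurable_discFun (p : ℕ) [Fact p.Prime] (N : ℕ) (α : ℕ → ℤ_[p]) :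
    Measurable fun z : ℤ_[p] × ℤ_[p] => discFun p N α z.1 z.2 := by
  unfold discFun
  simp only [Finset.card_filter, Nat.cast_sum, Nat.cast_ite, Nat.cast_one, Nat.cast_zero]
  refine ((Finset.measurable_fun_sum _ fun n _ => Measurable.ite ?_ measurable_const
    measurable_const).div_const _).sub measurable_snd.norm
  exact measurableSet_le (measurable_fst.const_sub (α n)).norm measurable_snd.norm

lemma abs_discFun_le_one (p : ℕ) [Fact p.Prime] (N : ℕ) (α : ℕ → ℤ_[p]) (x y : ℤ_[p]) :
    |discFun p N α x y| ≤ 1 := by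
  have hcard : (((Finset.Icc 1 N).filter fun n => ‖α n - x‖ ≤ ‖y‖).card : ℝ) / N ≤ 1 :=
    div_le_one_of_le₀ (mod_cast (Finset.card_filter_le _ _).trans (by simp)) (by positivity)
  have hcard' : 0 ≤ (((Finset.Icc 1 N).filter fun n => ‖α n - x‖ ≤ ‖y‖).card : ℝ) / N := by
    positivity
  have := y.norm_le_one
  have := norm_nonneg y
  rw [discFun, abs_le]
  constructor <;> linarith

lemma integrable_sq_abs_discFun (p : ℕ) [Fact p.Prime] (N : ℕ) (α : ℕ → ℤ_[p])
    (ν : Measure (ℤ_[p] × ℤ_[p])) [IsFiniteMeasure ν] :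
    Integrable (fun z : ℤ_[p] × ℤ_[p] => |discFun p N α z.1 z.2| ^ 2) ν := by
  refine .of_bound (((measurable_discFun p N α).abs.pow_const 2).aestronglyMeasurable) 1
    (.of_forall fun z => ?_)
  rw [Real.norm_of_nonneg (by positivity)]
  exact pow_le_one₀ (abs_nonneg _) (abs_discFun_le_one p N α z.1 z.2)

/-- The local discrepancy only depends on the disc `D(x, |y|_p)`. -/
lemma discFun_congr (p : ℕ) [Fact p.Prime] (N : ℕ) (α : ℕ → ℤ_[p]) {x y x₀ y₀ : ℤ_[p]}
    (hx : ‖x - x₀‖ ≤ ‖y₀‖) (hy : ‖y‖ = ‖y₀‖) :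
    discFun p N α x y = discFun p N α x₀ y₀ := by
  have hball : Metric.closedBall x ‖y₀‖ = Metric.closedBall x₀ ‖y₀‖ :=
    IsUltrametricDist.closedBall_eq_of_mem (by rwa [mem_closedBall_iff_norm'])
  have hiff : ∀ z : ℤ_[p], ‖z - x‖ ≤ ‖y₀‖ ↔ ‖z - x₀‖ ≤ ‖y₀‖ := fun z => by
    rw [← mem_closedBall_iff_norm, hball, mem_closedBall_iff_norm]
  simp only [discFun, hy, hiff]

/-- Case 2 of Lemma 3.1: if `f(x₀,y₀) < 0`, where
`f(x,y) = #{n ≤ N : αₙ ∈ D(x,|y|_p)}/N - |y|_p`, and `Δ = -f(x₀,y₀)`, then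
`∬ |f(x,y)|² dμ(x) dμ(y) ≥ (1 - 1/p) Δ⁴`. -/
theorem l2_lower_bound_negative_case (p : ℕ) [Fact p.Prime] (μ : Measure ℤ_[p])
    [μ.IsAddHaarMeasure] [IsProbabilityMeasure μ]
    (N : ℕ) (hN : 1 ≤ N) (α : ℕ → ℤ_[p]) (x₀ y₀ : ℤ_[p])
    (h : discFun p N α x₀ y₀ < 0) :
    (1 - 1 / (p : ℝ)) * (-(discFun p N α x₀ y₀)) ^ 4
      ≤ ∫ x, ∫ y, |discFun p N α x y| ^ 2 ∂μ ∂μ := by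
  have hcount : 0 ≤ (((Finset.Icc 1 N).filter fun n => ‖α n - x₀‖ ≤ ‖y₀‖).card : ℝ) / N := by
    positivity
  have hΔ : -discFun p N α x₀ y₀ ≤ ‖y₀‖ := by
    rw [discFun]
    linarith
  have hy₀ : y₀ ≠ 0 := norm_pos_iff.mp (by linarith)
  set Δ := -discFun p N α x₀ y₀ with hΔdef
  have hp : (1 : ℝ) < p := mod_cast (Fact.out : p.Prime).one_lt
  have hfac : 0 ≤ 1 - 1 / (p : ℝ) := by
    rw [sub_nonneg, div_le_one (by positivity)]
    exact hp.le
  rw [← integral_prod _ (integrable_sq_abs_discFun p N α (μ.prod μ))]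
  have hmarkov := mul_meas_ge_le_integral_of_nonneg
    (.of_forall fun z : ℤ_[p] × ℤ_[p] => by positivity)
    (integrable_sq_abs_discFun p N α (μ.prod μ)) (Δ ^ 2)
  have hsub : Metric.closedBall x₀ ‖y₀‖ ×ˢ {y : ℤ_[p] | ‖y‖ = ‖y₀‖}
      ⊆ {z : ℤ_[p] × ℤ_[p] | Δ ^ 2 ≤ |discFun p N α z.1 z.2| ^ 2} := by
    rintro ⟨x, y⟩ ⟨hx, hy⟩
    rw [Set.mem_ofPred_eq, discFun_congr p N α (mem_closedBall_iff_norm.mp hx) hy, sq_abs, hΔdef,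
      neg_sq]
  have hmeas := measureReal_mono (μ := μ.prod μ) hsub
  rw [measureReal_prod_prod] at hmeas
  have hball : μ.real (Metric.closedBall x₀ ‖y₀‖) = ‖y₀‖ := by
    rw [PadicInt.norm_eq_zpow_neg_valuation hy₀, measureReal_closedBall_zpow]
  have hsphere : μ.real {y : ℤ_[p] | ‖y‖ = ‖y₀‖} = (1 - 1 / (p : ℝ)) * ‖y₀‖ := by
    rw [PadicInt.norm_eq_zpow_neg_valuation hy₀, measureReal_norm_eq_zpow]
  rw [hball, hsphere] at hmeas
  calc (1 - 1 / (p : ℝ)) * Δ ^ 4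
      = Δ ^ 2 * ((1 - 1 / (p : ℝ)) * Δ ^ 2) := by ring
    _ ≤ Δ ^ 2 * ((1 - 1 / (p : ℝ)) * ‖y₀‖ ^ 2) := by gcongr; linarith
    _ = Δ ^ 2 * (‖y₀‖ * ((1 - 1 / (p : ℝ)) * ‖y₀‖)) := by ring
    _ ≤ _ := (mul_le_mul_of_nonneg_left hmeas (sq_nonneg Δ)).trans hmarkov
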